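/- The number of N × N sign matrices (entries ±1) with sign spiky rank at most r, where r ≤ N/2, is at most N^{6rN}. -/

import Mathlib

open Matrix MeasureTheory

/-- A blocky matrix: its support is a disjoint union of combinatorial rectangles,
with value 1 on the support and 0 elsewhere. -/
def IsBlocky {F : Type*} [Field F] {m n : Type*} (M : Matrix m n F) : Prop :=
  ∃ (k : ℕ) (S : Fin k → Finset m) (T : Fin k → Finset n),
    (∀ a b, a ≠ b → Disjoint (S a) (S b)) ∧
    (∀ a b, a ≠ b → Disjoint (T a) (T b)) ∧
    (∀ i j, (∃ l, i ∈ S l ∧ j ∈ T l) → M i j = 1) ∧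
    (∀ i j, (¬ ∃ l, i ∈ S l ∧ j ∈ T l) → M i j = 0)

/-- A spiky matrix: the entrywise product of a blocky matrix and a rank-one matrix. -/
def IsSpiky {F : Type*} [Field F] {m n : Type*} (M : Matrix m n F) : Prop :=
  ∃ (B : Matrix m n F) (u : m → F) (v : n → F),
    IsBlocky B ∧ ∀ i j, M i j = B i j * (u i * v j)

/-- The spiky rank: minimum number of spiky matrices summing to `M`. -/
noncomputable def spikyRank {F : Type*} [Field F] {m n : Type*} (M : Matrix m n F) : ℕ :=
  sInf {r | ∃ f : Fin r → Matrix m n F, (∀ i, IsSpiky (f i)) ∧ ∑ i, f i = M}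

/-- The blocky rank: minimum number of blocky matrices whose linear combination equals `M`. -/
noncomputable def blockyRank {F : Type*} [Field F] {m n : Type*} (M : Matrix m n F) : ℕ :=
  sInf {r | ∃ (f : Fin r → Matrix m n F) (c : Fin r → F),
    (∀ i, IsBlocky (f i)) ∧ ∑ i, c i • f i = M}

/-- Sparsity: the number of nonzero entries of a matrix. -/
noncomputable def matSparsity {F : Type*} [Zero F] {m n : Type*} (M : Matrix m n F) : ℕ :=
  {p : m × n | M p.1 p.2 ≠ 0}.ncard

/-- Rank-`r` rigidity: minimum number of entries that must be changed to bring the rank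
down to `r`. -/
noncomputable def rigidity {F : Type*} [Field F] {N : ℕ}
    (M : Matrix (Fin N) (Fin N) F) (r : ℕ) : ℕ :=
  sInf {s | ∃ A C : Matrix (Fin N) (Fin N) F, M = A + C ∧ A.rank ≤ r ∧ matSparsity C ≤ s}

/-- Sign spiky rank: minimum spiky rank over real matrices with the same sign pattern. -/
noncomputable def signSpikyRank {m n : Type*} (M : Matrix m n ℝ) : ℕ :=
  sInf {r | ∃ A : Matrix m n ℝ,
    (∀ i j, Real.sign (A i j) = Real.sign (M i j)) ∧ spikyRank A ≤ r}

/-- Blocky cover number: minimum number of blocky matrices whose supports' union is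
exactly the set of 1-entries of the Boolean matrix `M`. -/
noncomputable def blockyCover {m n : Type*} (M : Matrix m n ℝ) : ℕ :=
  sInf {k | ∃ f : Fin k → Matrix m n ℝ, (∀ l, IsBlocky (f l)) ∧
    ∀ i j, M i j = 1 ↔ ∃ l, f l i j = 1}

namespace MvPolynomial

theorem finrank_restrictTotalDegree (σ R : Type*) [Fintype σ] [Field R] (K : ℕ) :
    Module.finrank R (restrictTotalDegree σ R K)
      = (K + Fintype.card σ).choose (Fintype.card σ) := by
  classical
  have hset : {n : σ →₀ ℕ | (n.sum fun _ e => e) ≤ K}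
      = ↑((Finset.range (K + 1)).biUnion fun i =>
          (Finset.univ : Finset σ).finsuppAntidiag i) := by
    ext n
    simp [Finset.mem_finsuppAntidiag, Finsupp.sum_fintype]
  have hcard : Module.finrank R (restrictTotalDegree σ R K)
      = Nat.card {n : σ →₀ ℕ | (n.sum fun _ e => e) ≤ K} :=
    Module.finrank_eq_nat_card_basis (basisRestrictSupport R _)
  rw [hcard, hset, Nat.card_coe_set_eq, Set.ncard_coe_finset, Finset.card_biUnion,
    ← Nat.sum_range_multichoose]
  · simp [Finset.card_finsuppAntidiag_nat_eq_multichoose]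
  · intro i _ j _ hij
    rw [Function.onFun, Finset.disjoint_left]
    intro n hi hj
    rw [Finset.mem_finsuppAntidiag] at hi hj
    exact hij (hi.1.symm.trans hj.1)

theorem eval_aeval {σ τ R : Type*} [CommSemiring R] (P : σ → MvPolynomial τ R)
    (Q : MvPolynomial σ R) (x : τ → R) :
    eval x (aeval P Q) = eval (fun i => eval x (P i)) Q := by
  induction Q using MvPolynomial.induction_on with
  | C a => simp
  | add p q hp hq => simp only [map_add, hp, hq]
  | mul_X p i hp => simp only [map_mul, hp, aeval_X, eval_X]

theorem totalDegree_aeval_le {σ τ R : Type*} [CommSemiring R] (P : σ → MvPolynomial τ R)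
    {D : ℕ} (hP : ∀ i, (P i).totalDegree ≤ D) (Q : MvPolynomial σ R) :
    (aeval P Q).totalDegree ≤ D * Q.totalDegree := by
  rw [aeval_def, eval₂_eq]
  refine totalDegree_finsetSum_le fun e he => ?_
  refine (totalDegree_mul _ _).trans ?_
  rw [algebraMap_eq, totalDegree_C, zero_add]
  refine (totalDegree_finsetProd _ _).trans ?_
  calc ∑ i ∈ e.support, (P i ^ e i).totalDegree ≤ ∑ i ∈ e.support, D * e i :=
        Finset.sum_le_sum fun i _ => (totalDegree_pow _ _).trans <| by
          rw [mul_comm]; exact Nat.mul_le_mul_right _ (hP i)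
    _ = D * e.sum fun _ k => k := by rw [← Finset.mul_sum]; rfl
    _ ≤ D * Q.totalDegree := Nat.mul_le_mul_left _ (le_totalDegree he)

theorem totalDegree_pderiv_le {σ R : Type*} [CommSemiring R] (i : σ) (p : MvPolynomial σ R) :
    (pderiv i p).totalDegree ≤ p.totalDegree - 1 := by
  classical
  rw [p.as_sum, map_sum]
  rw [← p.as_sum]
  refine totalDegree_finsetSum_le fun e he => ?_
  rw [pderiv_monomial]
  by_cases h : e i = 0
  · simp [h]
  refine (totalDegree_monomial_le _ _).trans ?_
  have h1 : (e - Finsupp.single i 1).degree + 1 = e.degree := by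
    have hle : Finsupp.single i 1 ≤ e := by
      simpa [Finsupp.single_le_iff] using Nat.one_le_iff_ne_zero.2 h
    conv_rhs => rw [← tsub_add_cancel_of_le hle, map_add]
    simp
  have h2 : e.degree ≤ p.totalDegree := le_totalDegree he
  change (e - Finsupp.single i 1).degree ≤ _
  omega

/-- Lagrange interpolation: distinct points are separated by real polynomials. -/
theorem exists_eval_eq_ite {σ α : Type*} [Fintype σ] [Fintype α] [DecidableEq α]
    (z : α → σ → ℝ) (hz : Function.Injective z) :
    ∃ h : α → MvPolynomial σ ℝ, ∀ a b, eval (z b) (h a) = if a = b then 1 else 0 := by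
  let q : α → MvPolynomial σ ℝ := fun b => ∑ k, (X k - C (z b k)) ^ 2
  have hq : ∀ b c, eval (z c) (q b) = ∑ k, (z c k - z b k) ^ 2 := by simp [q]
  have hne : ∀ a, ∏ b ∈ Finset.univ.erase a, eval (z a) (q b) ≠ 0 := by
    intro a
    refine Finset.prod_ne_zero_iff.2 fun b hb h0 => (Finset.ne_of_mem_erase hb).symm ?_
    rw [hq, Finset.sum_eq_zero_iff_of_nonneg fun _ _ => sq_nonneg _] at h0
    refine hz (_root_.funext fun k => ?_)
    have := pow_eq_zero_iff (two_ne_zero) |>.1 (h0 k (Finset.mem_univ k))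
    linarith
  refine ⟨fun a => C (∏ b ∈ Finset.univ.erase a, eval (z a) (q b))⁻¹ *
    ∏ b ∈ Finset.univ.erase a, q b, fun a b => ?_⟩
  rw [map_mul, eval_C, map_prod]
  split_ifs with hab
  · subst hab
    exact inv_mul_cancel₀ (hne a)
  · refine mul_eq_zero_of_right _
      (Finset.prod_eq_zero (i := b) (Finset.mem_erase.2 ⟨Ne.symm hab, Finset.mem_univ b⟩) ?_)
    rw [hq]; simp

theorem contDiff_eval {σ : Type*} [Fintype σ] (p : MvPolynomial σ ℝ) {n : WithTop ℕ∞} :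
    ContDiff ℝ n fun x : σ → ℝ => eval x p :=
  (AnalyticOnNhd.eval_mvPolynomial p).contDiff

theorem hasFDerivAt_eval {σ : Type*} [Fintype σ] (p : MvPolynomial σ ℝ) (x : σ → ℝ) :
    HasFDerivAt (fun y : σ → ℝ => eval y p)
      (∑ k, eval x (pderiv k p) • ContinuousLinearMap.proj (R := ℝ) (φ := fun _ : σ => ℝ) k) x := by
  classical
  induction p using MvPolynomial.induction_on with
  | C a => simpa using hasFDerivAt_const a x
  | add p q hp hq =>
    simp only [map_add, add_smul, Finset.sum_add_distrib]
    exact hp.add hq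
  | mul_X p i hp =>
    have hX := (ContinuousLinearMap.proj (R := ℝ) (φ := fun _ : σ => ℝ) i).hasFDerivAt (x := x)
    simp only [map_mul, eval_X]
    refine (hp.mul hX).congr_fderiv ?_
    ext v
    simp [pderiv_X, Pi.single_apply, Derivation.leibniz, add_mul, Finset.sum_add_distrib,
      Finset.mul_sum, apply_ite, ite_mul, mul_assoc]

/-- A weak form of Bézout's theorem: a square system of real polynomials of degree at most `D`
in `n` variables has at most `D ^ n` nondegenerate real solutions. -/
theorem card_nondegenerate_zeros_le {σ α : Type*} [Fintype σ] [Fintype α]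
    (P : σ → MvPolynomial σ ℝ) {D : ℕ} (hP : ∀ i, (P i).totalDegree ≤ D)
    (z : α → σ → ℝ) (hz : Function.Injective z) (hzero : ∀ a i, eval (z a) (P i) = 0)
    (hdet : ∀ a, (fderiv ℝ (fun x i => eval x (P i)) (z a)).det ≠ 0) :
    Fintype.card α ≤ D ^ Fintype.card σ := by
  classical
  obtain ⟨h, hh⟩ := exists_eval_eq_ite z hz
  set F : (σ → ℝ) → σ → ℝ := fun x i => eval x (P i) with hF
  have hFsmooth : ContDiff ℝ 1 F := contDiff_pi.2 fun i => contDiff_eval (P i)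
  have hFz : ∀ a, F (z a) = 0 := fun a => _root_.funext fun i => hzero a i
  -- local inverse branches of the polynomial map
  have hbranch : ∀ a, ∃ g : (σ → ℝ) → σ → ℝ, ContinuousAt g 0 ∧ g 0 = z a ∧
      ∀ᶠ y in nhds 0, F (g y) = y := by
    intro a
    have hs : HasStrictFDerivAt F
        (((fderiv ℝ F (z a)).toContinuousLinearEquivOfDetNeZero (hdet a) :
          (σ → ℝ) ≃L[ℝ] (σ → ℝ)) : (σ → ℝ) →L[ℝ] (σ → ℝ)) (z a) := by
      simpa using hFsmooth.contDiffAt.hasStrictFDerivAt one_ne_zero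
    refine ⟨hs.localInverse F _ _, ?_, ?_, ?_⟩
    · simpa [hFz] using hs.localInverse_continuousAt
    · simpa [hFz] using hs.localInverse_apply_image
    · simpa [hFz] using hs.eventually_right_inverse
  choose g hgcont hg0 hgF using hbranch
  have hinj : ∀ Q : α → MvPolynomial σ ℝ, ∑ a, h a * aeval P (Q a) = 0 → Q = 0 := by
    intro Q hQ
    let A : (σ → ℝ) → Matrix α α ℝ := fun y => Matrix.of fun b a => eval (g b y) (h a)
    have hA : ContinuousAt (fun y => (A y).det) 0 := by
      refine ContinuousAt.comp (g := Matrix.det) (f := A)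
        (Continuous.matrix_det continuous_id).continuousAt ?_
      refine continuousAt_pi.2 fun b => continuousAt_pi.2 fun a => ?_
      exact ContinuousAt.comp (g := fun x => eval x (h a))
        (MvPolynomial.continuous_eval (h a)).continuousAt (hgcont b)
    have hA0 : (A 0).det ≠ 0 := by
      have : A 0 = 1 := by
        ext b a
        simp [A, hg0, hh, Matrix.one_apply, eq_comm]
      simp [this]
    have hev : ∀ᶠ y in nhds 0, ∀ a, eval y (Q a) = 0 := by
      filter_upwards [hA.eventually_ne hA0, Filter.eventually_all.2 hgF] with y hy1 hy2
      have hmul : A y *ᵥ (fun a => eval y (Q a)) = 0 := by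
        funext b
        have := congrArg (eval (g b y)) hQ
        rw [map_sum, map_zero] at this
        rw [Pi.zero_apply, ← this]
        refine Finset.sum_congr rfl fun a _ => ?_
        rw [map_mul]
        congr 1
        conv_lhs => rw [← hy2 b]
        exact (eval_aeval P (Q a) (g b y)).symm
      exact fun a => congrFun (Matrix.eq_zero_of_mulVec_eq_zero hy1 hmul) a
    obtain ⟨ε, hε, hball⟩ := Metric.eventually_nhds_iff_ball.1 hev
    funext a
    refine MvPolynomial.funext_set (fun _ : σ => Metric.ball (0 : ℝ) ε) (fun _ => ?_) fun x hx => ?_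
    · rw [Real.ball_eq_Ioo]; exact Set.Ioo_infinite (by linarith)
    · rw [Pi.zero_apply, map_zero]
      refine hball x ?_ a
      rw [ball_pi _ hε]; exact hx
  set D₀ := Finset.univ.sup fun a => (h a).totalDegree with hD₀
  set n := Fintype.card σ with hn
  have hdim : ∀ K : ℕ, Fintype.card α * (K + n).choose n ≤ (D * K + D₀ + n).choose n := by
    intro K
    let Φ : (α → restrictTotalDegree σ ℝ K) →ₗ[ℝ] restrictTotalDegree σ ℝ (D * K + D₀) :=
      LinearMap.codRestrict _
        (∑ a, (LinearMap.mulLeft ℝ (h a)) ∘ₗ (aeval P).toLinearMap ∘ₗ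
          (restrictTotalDegree σ ℝ K).subtype ∘ₗ LinearMap.proj a) (by
        intro Q
        rw [mem_restrictTotalDegree, LinearMap.sum_apply]
        refine totalDegree_finsetSum_le fun a _ => (totalDegree_mul _ _).trans ?_
        have h1 : (h a).totalDegree ≤ D₀ :=
          Finset.le_sup (f := fun a => (h a).totalDegree) (Finset.mem_univ a)
        have h2 := totalDegree_aeval_le P hP (Q a : MvPolynomial σ ℝ)
        have h3 := Nat.mul_le_mul_left D ((mem_restrictTotalDegree _ _ _).1 (Q a).2)
        simp only [LinearMap.comp_apply, LinearMap.proj_apply, Submodule.subtype_apply,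
          AlgHom.toLinearMap_apply]
        omega)
    have hΦ : Function.Injective Φ := by
      rw [← LinearMap.ker_eq_bot, LinearMap.ker_eq_bot']
      intro Q hQ
      have := hinj (fun a => (Q a : MvPolynomial σ ℝ)) (by
        simpa [Φ, LinearMap.sum_apply] using congrArg Subtype.val hQ)
      funext a
      exact Subtype.ext (congrFun this a)
    have := LinearMap.finrank_le_finrank_of_injective hΦ
    rw [Module.finrank_pi_fintype, finrank_restrictTotalDegree] at this
    simpa [finrank_restrictTotalDegree] using this
  have hpow : ∀ K : ℕ, Fintype.card α * K ^ n ≤ (D * K + D₀ + n) ^ n := by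
    intro K
    have h1 : K ^ n ≤ n.factorial * (K + n).choose n := by
      rw [← Nat.descFactorial_eq_factorial_mul_choose]
      calc K ^ n ≤ (K + n + 1 - n) ^ n := Nat.pow_le_pow_left (by omega) n
        _ ≤ _ := Nat.pow_sub_le_descFactorial _ _
    have h2 : n.factorial * (D * K + D₀ + n).choose n ≤ (D * K + D₀ + n) ^ n := by
      rw [← Nat.descFactorial_eq_factorial_mul_choose]
      exact Nat.descFactorial_le_pow _ _
    calc Fintype.card α * K ^ n
        ≤ Fintype.card α * (n.factorial * (K + n).choose n) := Nat.mul_le_mul_left _ h1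
      _ = n.factorial * (Fintype.card α * (K + n).choose n) := by ring
      _ ≤ n.factorial * (D * K + D₀ + n).choose n := Nat.mul_le_mul_left _ (hdim K)
      _ ≤ _ := h2
  have hlim : Filter.Tendsto (fun K : ℕ => ((D : ℝ) + (D₀ + n : ℝ) / K) ^ n) Filter.atTop
      (nhds (((D : ℝ) + 0) ^ n)) :=
    (tendsto_const_nhds.add (tendsto_const_div_atTop_nhds_zero_nat _)).pow n
  have hle : (Fintype.card α : ℝ) ≤ ((D : ℝ) + 0) ^ n := by
    refine ge_of_tendsto hlim (Filter.eventually_atTop.2 ⟨1, fun K hK => ?_⟩)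
    have hK0 : (0 : ℝ) < K := by exact_mod_cast hK
    have h3 : (Fintype.card α : ℝ) * K ^ n ≤ (D * K + D₀ + n) ^ n := by exact_mod_cast hpow K
    have h4 : ((D : ℝ) + (D₀ + n : ℝ) / K) ^ n = (D * K + D₀ + n) ^ n / K ^ n := by
      rw [← div_pow]; congr 1; field_simp; ring
    rw [h4, le_div_iff₀ (by positivity)]
    exact h3
  rw [add_zero] at hle
  exact_mod_cast hle

/-- If `G` is nonzero at a point of a bounded open set and vanishes on its boundary,
then its gradient attains every sufficiently small value on that set. -/
theorem eventually_exists_gradient_eq {σ : Type*} [Fintype σ] (G : MvPolynomial σ ℝ) {e : ℝ}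
    (he : e ≠ 0) {K U : Set (σ → ℝ)} (hK : IsCompact K) (hU : IsOpen U) (hUK : U ⊆ K)
    {x₀ : σ → ℝ} (hx₀ : x₀ ∈ U) (hpos : 0 < e * eval x₀ G)
    (hbd : ∀ x ∈ K, x ∉ U → eval x G = 0) :
    ∀ᶠ c : σ → ℝ in nhds 0, ∃ p ∈ U, ∀ k, eval p (pderiv k G) = c k := by
  classical
  obtain ⟨B, hB⟩ := hK.isBounded.exists_norm_le
  have hsmall : ∀ᶠ c : σ → ℝ in nhds 0, |e| * ((∑ k, |c k|) * B) < e * eval x₀ G / 2 := by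
    have hcont : Continuous fun c : σ → ℝ => |e| * ((∑ k, |c k|) * B) := by fun_prop
    have := hcont.tendsto 0
    simp only [Pi.zero_apply, abs_zero, Finset.sum_const_zero, zero_mul, mul_zero] at this
    exact this.eventually_lt_const (half_pos hpos)
  filter_upwards [hsmall] with c hc
  have hpair : ∀ y ∈ K, |e * ∑ k, c k * y k| < e * eval x₀ G / 2 := by
    intro y hy
    refine lt_of_le_of_lt ?_ hc
    rw [abs_mul]
    refine mul_le_mul_of_nonneg_left ?_ (abs_nonneg e)
    rw [Finset.sum_mul]
    refine (Finset.abs_sum_le_sum_abs _ _).trans (Finset.sum_le_sum fun k _ => ?_)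
    rw [abs_mul]
    exact mul_le_mul_of_nonneg_left ((norm_le_pi_norm y k).trans (hB y hy)) (abs_nonneg _)
  let ψ : (σ → ℝ) → ℝ := fun y => e * (eval y G - ∑ k, c k * y k)
  have hψ : Continuous ψ :=
    continuous_const.mul ((MvPolynomial.continuous_eval G).sub (by fun_prop))
  obtain ⟨p, hpK, hp⟩ := hK.exists_isMaxOn ⟨x₀, hUK hx₀⟩ hψ.continuousOn
  have hpU : p ∈ U := by
    by_contra hpU
    have h1 : ψ x₀ ≤ ψ p := hp (hUK hx₀)
    simp only [ψ, hbd p hpK hpU, mul_sub, mul_zero] at h1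
    have h2 := abs_lt.1 (hpair x₀ (hUK hx₀))
    have h3 := abs_lt.1 (hpair p hpK)
    linarith
  refine ⟨p, hpU, fun k => ?_⟩
  have hmax : IsLocalMax ψ p :=
    (hp.on_subset hUK).isLocalMax (hU.mem_nhds hpU)
  have hlin : HasFDerivAt (fun y : σ → ℝ => ∑ k, c k * y k)
      (∑ k, c k • ContinuousLinearMap.proj (R := ℝ) (φ := fun _ : σ => ℝ) k) p :=
    HasFDerivAt.fun_sum fun k _ =>
      ((ContinuousLinearMap.proj (R := ℝ) (φ := fun _ : σ => ℝ) k).hasFDerivAt).const_mul (c k)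
  have hder := hmax.hasFDerivAt_eq_zero (((hasFDerivAt_eval G p).sub hlin).const_mul e)
  have hk := DFunLike.congr_fun hder (Pi.single k 1)
  simp [Pi.single_apply, he] at hk
  linarith

/-- A weak form of Warren's theorem: `m` real polynomials of degree at most `d` in `n` variables
realize at most `(d * m + 1) ^ n` sign patterns without zeros. -/
theorem ncard_sign_patterns_le {σ ι : Type*} [Fintype σ] [Fintype ι]
    (f : ι → MvPolynomial σ ℝ) {d : ℕ} (hf : ∀ i, (f i).totalDegree ≤ d) :
    {s : ι → SignType | (∀ i, s i ≠ 0) ∧ ∃ x, ∀ i, SignType.sign (eval x (f i)) = s i}.ncard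
      ≤ (d * Fintype.card ι + 1) ^ Fintype.card σ := by
  classical
  set S := {s : ι → SignType |
    (∀ i, s i ≠ 0) ∧ ∃ x, ∀ i, SignType.sign (eval x (f i)) = s i} with hS
  have : Fintype S := Fintype.ofFinite S
  have hx : ∀ a : S, ∃ x, ∀ i, SignType.sign (eval x (f i)) = a.1 i := fun a => a.2.2
  choose x hx using hx
  obtain ⟨R, hR⟩ := (Set.finite_range fun a => ∑ k, x a k ^ 2).bddAbove
  let q : MvPolynomial σ ℝ := C (R + 1) - ∑ k, X k ^ 2
  have hq : ∀ y, eval y q = R + 1 - ∑ k, y k ^ 2 := fun y => by simp [q]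
  let G := q * ∏ i, f i
  have hGdeg : G.totalDegree ≤ d * Fintype.card ι + 2 := by
    have h1 : q.totalDegree ≤ 2 := by
      refine (totalDegree_sub _ _).trans (max_le (by rw [totalDegree_C]; omega) ?_)
      exact totalDegree_finsetSum_le fun k _ => by simp
    have h2 : (∏ i, f i).totalDegree ≤ d * Fintype.card ι := by
      refine (totalDegree_finsetProd _ _).trans ((Finset.sum_le_sum fun i _ => hf i).trans ?_)
      simp [mul_comm]
    exact (totalDegree_mul _ _).trans (by omega)
  let U : S → Set (σ → ℝ) := fun a =>
    {y | 0 < eval y q ∧ ∀ i, 0 < (a.1 i : ℝ) * eval y (f i)}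
  let K : S → Set (σ → ℝ) := fun a =>
    {y | 0 ≤ eval y q ∧ ∀ i, 0 ≤ (a.1 i : ℝ) * eval y (f i)}
  have hUsign : ∀ a, ∀ y ∈ U a, ∀ i, SignType.sign (eval y (f i)) = a.1 i := by
    intro a y hy i
    have h1 := hy.2 i
    have h2 := a.2.1 i
    generalize a.1 i = t at h1 h2
    cases t
    · exact absurd rfl h2
    · exact sign_neg (by simpa using h1)
    · exact sign_pos (by simpa using h1)
  have hcrit : ∀ a, ∀ᶠ c : σ → ℝ in nhds 0, ∃ p ∈ U a, ∀ k, eval p (pderiv k G) = c k := by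
    intro a
    have hcont : ∀ i, Continuous fun y : σ → ℝ => (a.1 i : ℝ) * eval y (f i) := fun i =>
      continuous_const.mul (MvPolynomial.continuous_eval (f i))
    have hKclosed : IsClosed (K a) := by
      simp only [K, Set.ofPred_and, Set.ofPred_forall]
      exact (isClosed_le continuous_const (MvPolynomial.continuous_eval q)).inter
        (isClosed_iInter fun i => isClosed_le continuous_const (hcont i))
    have hUopen : IsOpen (U a) := by
      simp only [U, Set.ofPred_and, Set.ofPred_forall]
      exact (isOpen_lt continuous_const (MvPolynomial.continuous_eval q)).inter
        (isOpen_iInter_of_finite fun i => isOpen_lt continuous_const (hcont i))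
    have hKcompact : IsCompact (K a) := by
      refine Metric.isCompact_of_isClosed_isBounded hKclosed
        (isBounded_iff_forall_norm_le.2 ⟨|R + 1| + 1, fun y hy => ?_⟩)
      refine (pi_norm_le_iff_of_nonneg (by positivity)).2 fun k => ?_
      have h1 := hy.1
      rw [hq] at h1
      have h2 : y k ^ 2 ≤ ∑ k, y k ^ 2 :=
        Finset.single_le_sum (f := fun k => y k ^ 2) (fun _ _ => sq_nonneg _) (Finset.mem_univ k)
      have h3 := le_abs_self (R + 1)
      rw [Real.norm_eq_abs]
      refine abs_le_of_sq_le_sq ?_ (by positivity)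
      nlinarith [abs_nonneg (R + 1)]
    have hx0 : x a ∈ U a := by
      refine ⟨?_, fun i => ?_⟩
      · rw [hq]
        have : ∑ k, x a k ^ 2 ≤ R := hR ⟨a, rfl⟩
        linarith
      · have h2 := a.2.1 i
        rw [← hx a i] at h2 ⊢
        rw [sign_ne_zero] at h2
        rw [sign_mul_self]
        exact abs_pos.2 h2
    have hG : ∀ y, (∏ i, (a.1 i : ℝ)) * eval y G
        = eval y q * ∏ i, ((a.1 i : ℝ) * eval y (f i)) := by
      intro y
      simp only [G, map_mul, map_prod, Finset.prod_mul_distrib]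
      ring
    have he : (∏ i, (a.1 i : ℝ)) ≠ 0 := by
      refine Finset.prod_ne_zero_iff.2 fun i _ => ?_
      have h2 := a.2.1 i
      generalize a.1 i = t at h2
      cases t
      · exact absurd rfl h2
      · simp
      · simp
    refine eventually_exists_gradient_eq G he hKcompact hUopen ?_ hx0 ?_ ?_
    · exact fun y hy => ⟨hy.1.le, fun i => (hy.2 i).le⟩
    · rw [hG]
      exact mul_pos hx0.1 (Finset.prod_pos fun i _ => hx0.2 i)
    · intro y hyK hyU
      refine (mul_eq_zero.1 ?_).resolve_left he
      rw [hG]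
      by_contra hne
      rw [mul_eq_zero, not_or, ← ne_eq (∏ i, _), Finset.prod_ne_zero_iff] at hne
      exact hyU ⟨lt_of_le_of_ne hyK.1 (Ne.symm hne.1),
        fun i => lt_of_le_of_ne (hyK.2 i) (Ne.symm (hne.2 i (Finset.mem_univ i)))⟩
  set F : (σ → ℝ) → σ → ℝ := fun y k => eval y (pderiv k G) with hF
  have hFsmooth : ContDiff ℝ 1 F := contDiff_pi.2 fun k => contDiff_eval _
  have hsard : volume (F '' {y | (fderiv ℝ F y).det = 0}) = 0 :=
    addHaar_image_eq_zero_of_det_fderivWithin_eq_zero volume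
      (fun y _ => ((hFsmooth.differentiable one_ne_zero) y).hasFDerivAt.hasFDerivWithinAt)
      fun y hy => hy
  obtain ⟨c, hc, hcreg⟩ : ∃ c : σ → ℝ,
      (∀ a, ∃ p ∈ U a, ∀ k, eval p (pderiv k G) = c k) ∧
      c ∉ F '' {y | (fderiv ℝ F y).det = 0} := by
    have hdense := Measure.dense_of_ae (measure_eq_zero_iff_ae_notMem.1 hsard)
    obtain ⟨V, hVsub, hVopen, hV0⟩ := eventually_nhds_iff.1 (Filter.eventually_all.2 hcrit)
    obtain ⟨c, hcV, hc⟩ := hdense.inter_open_nonempty V hVopen ⟨0, hV0⟩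
    exact ⟨c, hVsub c hcV, hc⟩
  choose p hpU hp using hc
  have hFp : ∀ a, F (p a) = c := fun a => _root_.funext fun k => hp a k
  rw [← Nat.card_coe_set_eq, Nat.card_eq_fintype_card]
  refine card_nondegenerate_zeros_le (fun k => pderiv k G - C (c k)) (fun k => ?_) p ?_ ?_ ?_
  · refine (totalDegree_sub _ _).trans (max_le ((totalDegree_pderiv_le _ _).trans ?_) (by simp))
    omega
  · intro a b hab
    refine Subtype.ext (_root_.funext fun i => ?_)
    rw [← hUsign a _ (hpU a) i, ← hUsign b _ (hpU b) i, hab]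
  · intro a k
    simp [hp]
  · intro a h0
    refine hcreg ⟨p a, ?_, hFp a⟩
    have : (fun y k => eval y (pderiv k G - C (c k))) = fun y => F y - c := by
      ext y k; simp [F]
    rw [this, fderiv_sub_const] at h0
    exact h0

end MvPolynomial

/-- Row and column labellings describing the supports of spiky matrices: the row labels are
representatives of the blocks, and each representative labels itself. -/
noncomputable def blockLabelings (α : Type*) [Fintype α] [DecidableEq α] :
    Finset ((α → α) × (α → α)) :=
  Finset.univ.biUnion fun R : Finset α =>
    Fintype.piFinset (fun i => if i ∈ R then {i} else R) ×ˢ Fintype.piFinset fun _ => R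

theorem mem_blockLabelings {α : Type*} [Fintype α] [DecidableEq α] {p : (α → α) × (α → α)} :
    p ∈ blockLabelings α ↔ ∃ R : Finset α, (∀ i, p.1 i ∈ if i ∈ R then {i} else R) ∧
      ∀ j, p.2 j ∈ R := by
  simp [blockLabelings, Fintype.mem_piFinset]

theorem card_blockLabelings_le (α : Type*) [Fintype α] [DecidableEq α] :
    (blockLabelings α).card ≤ ∑ R : Finset α,
      R.card ^ (Fintype.card α - R.card) * R.card ^ Fintype.card α := by
  refine Finset.card_biUnion_le.trans (Finset.sum_le_sum fun R _ => le_of_eq ?_)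
  rw [Finset.card_product, Fintype.card_piFinset, Fintype.card_piFinset]
  congr 1
  · have : ∀ i, (if i ∈ R then {i} else R : Finset α).card = if i ∈ R then 1 else R.card := by
      intro i; split_ifs <;> simp
    simp [this, Finset.prod_ite, Finset.filter_not, Finset.card_sdiff]
  · simp

theorem IsSpiky.exists_blockLabeling {α : Type*} [Fintype α] [DecidableEq α] [Nonempty α]
    {M : Matrix α α ℝ} (hM : IsSpiky M) :
    ∃ p ∈ blockLabelings α, ∃ u v : α → ℝ,
      ∀ i j, M i j = if p.1 i = p.2 j then u i * v j else 0 := by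
  classical
  obtain ⟨B, u, v, ⟨k, S, T, hS, hT, hB1, hB0⟩, hM⟩ := hM
  have hrep : ∀ l, ∃ a, (S l).Nonempty → a ∈ S l := fun l => by
    by_cases h : (S l).Nonempty
    · exact ⟨h.choose, fun _ => h.choose_spec⟩
    · exact ⟨Classical.arbitrary α, fun h' => absurd h' h⟩
  choose rep hrep using hrep
  have hSuniq : ∀ {i l l'}, i ∈ S l → i ∈ S l' → l = l' := fun {i l l'} h h' => by
    by_contra hne
    exact Finset.disjoint_left.1 (hS l l' hne) h h'
  have hTuniq : ∀ {j l l'}, j ∈ T l → j ∈ T l' → l = l' := fun {j l l'} h h' => by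
    by_contra hne
    exact Finset.disjoint_left.1 (hT l l' hne) h h'
  let ρ : α → α := fun i => if h : ∃ l, i ∈ S l then rep h.choose else i
  have hρ : ∀ {i l}, i ∈ S l → ρ i = rep l := fun {i l} h => by
    have hex : ∃ l, i ∈ S l := ⟨l, h⟩
    simp only [ρ, dif_pos hex]
    rw [hSuniq hex.choose_spec h]
  have hρrep : ∀ {l}, (S l).Nonempty → ρ (rep l) = rep l := fun {l} h => hρ (hrep l h)
  have hρρ : ∀ i, ρ (ρ i) = ρ i := fun i => by
    by_cases h : ∃ l, i ∈ S l
    · obtain ⟨l, hl⟩ := h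
      rw [hρ hl, hρrep ⟨i, hl⟩]
    · have : ρ i = i := dif_neg h
      rw [this, this]
  let γ : α → α := fun j =>
    if h : ∃ l, j ∈ T l ∧ (S l).Nonempty then rep h.choose else ρ (Classical.arbitrary α)
  have hγ : ∀ {j l}, j ∈ T l → (S l).Nonempty → γ j = rep l := fun {j l} h h' => by
    have hex : ∃ l, j ∈ T l ∧ (S l).Nonempty := ⟨l, h, h'⟩
    simp only [γ, dif_pos hex]
    rw [hTuniq hex.choose_spec.1 h]
  refine ⟨(ρ, γ), mem_blockLabelings.2 ⟨Finset.univ.filter fun i => ρ i = i, fun i => ?_,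
    fun j => ?_⟩, fun i => if ∃ l, i ∈ S l then u i else 0,
    fun j => if ∃ l, j ∈ T l ∧ (S l).Nonempty then v j else 0, fun i j => ?_⟩
  · split_ifs with h
    · simpa using h
    · simpa using hρρ i
  · simp only [Finset.mem_filter, Finset.mem_univ, true_and]
    by_cases h : ∃ l, j ∈ T l ∧ (S l).Nonempty
    · obtain ⟨l, hl, hne⟩ := h
      rw [hγ hl hne, hρrep hne]
    · have : γ j = ρ (Classical.arbitrary α) := dif_neg h
      rw [this, hρρ]
  · rw [hM]
    by_cases h : ∃ l, i ∈ S l ∧ j ∈ T l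
    · rw [hB1 i j h]
      obtain ⟨l, hi, hj⟩ := h
      rw [if_pos ((hρ hi).trans (hγ hj ⟨i, hi⟩).symm)]
      beta_reduce
      rw [if_pos ⟨l, hi⟩, if_pos ⟨l, hj, ⟨i, hi⟩⟩, one_mul]
    · rw [hB0 i j h, zero_mul]
      by_cases hi : ∃ l, i ∈ S l
      · by_cases hj : ∃ l, j ∈ T l ∧ (S l).Nonempty
        · obtain ⟨l, hl⟩ := hi
          obtain ⟨l', hl', hne⟩ := hj
          refine (if_neg fun heq => h ⟨l, hl, ?_⟩).symm
          change ρ i = γ j at heq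
          rw [hρ hl, hγ hl' hne] at heq
          have h1 := hrep l ⟨i, hl⟩
          rw [heq] at h1
          rwa [hSuniq h1 (hrep l' hne)]
        · simp [hj]
      · simp [hi]

theorem isSpiky_zero {F m n : Type*} [Field F] : IsSpiky (0 : Matrix m n F) :=
  ⟨0, 0, 0, ⟨0, Fin.elim0, Fin.elim0, fun a => a.elim0, fun a => a.elim0,
    fun _ _ ⟨l, _⟩ => l.elim0, fun _ _ _ => rfl⟩, fun _ _ => by simp⟩

theorem exists_sum_isSpiky {F m n : Type*} [Field F] [Fintype m] [Fintype n] [DecidableEq m]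
    (A : Matrix m n F) :
    ∃ (r : ℕ) (f : Fin r → Matrix m n F), (∀ i, IsSpiky (f i)) ∧ ∑ i, f i = A := by
  refine ⟨Fintype.card m,
    fun l => Matrix.of fun i j => if i = (Fintype.equivFin m).symm l then A i j else 0,
    fun l => ?_, ?_⟩
  · refine ⟨fun _ _ => 1, fun i => if i = (Fintype.equivFin m).symm l then 1 else 0,
      fun j => A ((Fintype.equivFin m).symm l) j,
      ⟨1, fun _ => Finset.univ, fun _ => Finset.univ, fun a b h => absurd (Subsingleton.elim a b) h,
        fun a b h => absurd (Subsingleton.elim a b) h, fun _ _ _ => rfl,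
        fun i j h => absurd ⟨0, Finset.mem_univ i, Finset.mem_univ j⟩ h⟩, fun i j => ?_⟩
    by_cases h : i = (Fintype.equivFin m).symm l <;> simp [h]
  · ext i j
    simp only [Matrix.sum_apply, Matrix.of_apply]
    rw [(Fintype.equivFin m).symm.sum_comp (fun a => if i = a then A i j else 0)]
    simp

theorem exists_sum_isSpiky_of_spikyRank_le {F m n : Type*} [Field F] [Fintype m] [Fintype n]
    {A : Matrix m n F} {r : ℕ} (hA : spikyRank A ≤ r) :
    ∃ f : Fin r → Matrix m n F, (∀ i, IsSpiky (f i)) ∧ ∑ i, f i = A := by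
  classical
  obtain ⟨f, hf, hsum⟩ := Nat.sInf_mem
    (s := {r | ∃ f : Fin r → Matrix m n F, (∀ i, IsSpiky (f i)) ∧ ∑ i, f i = A})
    (exists_sum_isSpiky A)
  change Fin (spikyRank A) → Matrix m n F at f
  obtain ⟨t, rfl⟩ := Nat.exists_eq_add_of_le hA
  refine ⟨Fin.append f fun _ => 0, fun i => ?_, ?_⟩
  · refine Fin.addCases (fun i => ?_) (fun i => ?_) i
    · rw [Fin.append_left]; exact hf i
    · rw [Fin.append_right]; exact isSpiky_zero
  · rw [Fin.sum_univ_add]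
    simp only [Fin.append_left, Fin.append_right, Finset.sum_const_zero, add_zero]
    exact hsum

theorem exists_of_signSpikyRank_le {m n : Type*} {M : Matrix m n ℝ} {r : ℕ}
    (hM : signSpikyRank M ≤ r) :
    ∃ A : Matrix m n ℝ, (∀ i j, Real.sign (A i j) = Real.sign (M i j)) ∧ spikyRank A ≤ r := by
  obtain ⟨A, hA, hr⟩ := Nat.sInf_mem
    (s := {r | ∃ A : Matrix m n ℝ,
      (∀ i j, Real.sign (A i j) = Real.sign (M i j)) ∧ spikyRank A ≤ r})
    ⟨spikyRank M, M, fun _ _ => rfl, le_rfl⟩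
  exact ⟨A, hA, hr.trans hM⟩

theorem SignType.sign_eq_of_realSign_eq {x y : ℝ} (h : Real.sign x = Real.sign y) :
    SignType.sign x = SignType.sign y := by
  rcases lt_trichotomy x 0 with hx | rfl | hx <;> rcases lt_trichotomy y 0 with hy | rfl | hy <;>
    simp_all [Real.sign_of_neg, Real.sign_of_pos] <;> norm_num at h

/-- The entry at `ij` of a sum of `r` spiky matrices with labellings `p`, as a polynomial in the
coordinates of the `r` rank-one factors. -/
noncomputable def spikySumEntry {α : Type*} [DecidableEq α] {r : ℕ}
    (p : Fin r → (α → α) × (α → α)) (ij : α × α) : MvPolynomial (Fin r × (α ⊕ α)) ℝ :=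
  ∑ k, if (p k).1 ij.1 = (p k).2 ij.2 then
    MvPolynomial.X (k, Sum.inl ij.1) * MvPolynomial.X (k, Sum.inr ij.2) else 0

theorem totalDegree_spikySumEntry_le {α : Type*} [DecidableEq α] {r : ℕ}
    (p : Fin r → (α → α) × (α → α)) (ij : α × α) : (spikySumEntry p ij).totalDegree ≤ 2 := by
  refine MvPolynomial.totalDegree_finsetSum_le fun k _ => ?_
  split_ifs
  · refine (MvPolynomial.totalDegree_mul _ _).trans ?_
    simp
  · simp

theorem exists_sign_eq_of_signSpikyRank_le {α : Type*} [Fintype α] [DecidableEq α] [Nonempty α]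
    {M : Matrix α α ℝ} {r : ℕ} (hM : signSpikyRank M ≤ r) :
    ∃ p : Fin r → (α → α) × (α → α), (∀ k, p k ∈ blockLabelings α) ∧
      ∃ x, ∀ ij : α × α, SignType.sign (MvPolynomial.eval x (spikySumEntry p ij))
        = SignType.sign (M ij.1 ij.2) := by
  obtain ⟨A, hAM, hA⟩ := exists_of_signSpikyRank_le hM
  obtain ⟨f, hf, hsum⟩ := exists_sum_isSpiky_of_spikyRank_le hA
  choose p hp u v huv using fun k => (hf k).exists_blockLabeling
  refine ⟨p, hp, fun t => Sum.elim (u t.1) (v t.1) t.2, fun ij => ?_⟩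
  rw [← SignType.sign_eq_of_realSign_eq (hAM ij.1 ij.2), ← hsum, Matrix.sum_apply]
  congr 1
  rw [spikySumEntry, map_sum]
  refine Finset.sum_congr rfl fun k _ => ?_
  rw [huv]
  split_ifs <;> simp

theorem injOn_sign_of_entries {α : Type*} :
    Set.InjOn (fun (M : Matrix α α ℝ) (ij : α × α) => SignType.sign (M ij.1 ij.2))
      {M | ∀ i j, M i j = 1 ∨ M i j = -1} := by
  intro M hM M' hM' h
  ext i j
  have hij := congrFun h (i, j)
  rcases hM i j with h1 | h1 <;> rcases hM' i j with h2 | h2 <;> simp_all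

theorem ncard_signSpikyRank_le {α : Type*} [Fintype α] [DecidableEq α] [Nonempty α] (r : ℕ) :
    {M : Matrix α α ℝ | (∀ i j, M i j = 1 ∨ M i j = -1) ∧ signSpikyRank M ≤ r}.ncard
      ≤ ((blockLabelings α).card *
          (2 * Fintype.card α ^ 2 + 1) ^ (2 * Fintype.card α)) ^ r := by
  classical
  rw [← (injOn_sign_of_entries.mono fun M hM => hM.1).ncard_image]
  let S : (Fin r → (α → α) × (α → α)) → Set (α × α → SignType) := fun p =>
    {s | (∀ ij, s ij ≠ 0) ∧
      ∃ x, ∀ ij, SignType.sign (MvPolynomial.eval x (spikySumEntry p ij)) = s ij}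
  refine (Set.ncard_le_ncard
    (t := ⋃ p ∈ Fintype.piFinset fun _ : Fin r => blockLabelings α, S p) ?_
    (Set.toFinite _)).trans ?_
  · rintro _ ⟨M, ⟨hM, hr⟩, rfl⟩
    obtain ⟨p, hp, x, hx⟩ := exists_sign_eq_of_signSpikyRank_le hr
    refine Set.mem_biUnion (Fintype.mem_piFinset.2 hp) ⟨fun ij => ?_, x, hx⟩
    rcases hM ij.1 ij.2 with h | h <;> simp [h]
  · refine (Finset.set_ncard_biUnion_le _ _).trans ?_
    calc ∑ p ∈ Fintype.piFinset fun _ : Fin r => blockLabelings α, (S p).ncard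
        ≤ ∑ _p ∈ Fintype.piFinset fun _ : Fin r => blockLabelings α,
            (2 * Fintype.card (α × α) + 1) ^ Fintype.card (Fin r × (α ⊕ α)) :=
          Finset.sum_le_sum fun p _ =>
            MvPolynomial.ncard_sign_patterns_le _ (totalDegree_spikySumEntry_le p)
      _ = _ := by
          rw [Finset.sum_const, Fintype.card_piFinset_const, smul_eq_mul, mul_pow, ← pow_mul]
          simp only [Fintype.card_prod, Fintype.card_sum, Fintype.card_fin]
          congr 2 <;> ring

theorem two_pow_mul_pow_le {N k : ℕ} (hN : 30 ≤ N) (hk : k ≤ N) :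
    2 ^ N * (k ^ (N - k) * k ^ N * (2 * N ^ 2 + 1) ^ (2 * N)) ≤ N ^ (6 * N) := by
  rcases Nat.eq_zero_or_pos k with rfl | hk0
  · rw [zero_pow (by omega : N ≠ 0)]; simp
  have hN' : (30 : ℝ) ≤ N := by exact_mod_cast hN
  have hk' : (k : ℝ) ≤ N := by exact_mod_cast hk
  have hk0' : (0 : ℝ) < k := by exact_mod_cast hk0
  have hNpos : (0 : ℝ) < N := by linarith
  set κ : ℝ := k / N with hκ
  have hκ0 : 0 < κ := by positivity
  have hκ1 : κ ≤ 1 := (div_le_one hNpos).2 hk'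
  have hkκ : (k : ℝ) = κ * N := by rw [hκ]; field_simp
  have hlogk : Real.log k ≤ Real.log N - Real.log 2 + 2 * κ - 1 := by
    have h1 := Real.log_le_sub_one_of_pos (x := 2 * κ) (by positivity)
    rw [Real.log_mul two_ne_zero hκ0.ne', hκ, Real.log_div hk0'.ne' hNpos.ne'] at h1
    linarith
  have hlogN : 4 * Real.log 2 ≤ Real.log N := by
    have : Real.log ((2 : ℝ) ^ 4) ≤ Real.log N := Real.log_le_log (by norm_num) (by linarith)
    rwa [Real.log_pow] at this
  have hlogq : Real.log (2 * (N : ℝ) ^ 2 + 1) ≤ Real.log 2 + 2 * Real.log N + 1 / 1800 := by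
    have h1 : 2 * (N : ℝ) ^ 2 + 1 = 2 * (N : ℝ) ^ 2 * (1 + 1 / (2 * (N : ℝ) ^ 2)) := by
      field_simp
    have h2 := Real.log_le_sub_one_of_pos (x := 1 + 1 / (2 * (N : ℝ) ^ 2)) (by positivity)
    have h3 : 1 / (2 * (N : ℝ) ^ 2) ≤ 1 / 1800 :=
      one_div_le_one_div_of_le (by norm_num) (by nlinarith)
    rw [h1, Real.log_mul (by positivity) (by positivity), Real.log_mul (by norm_num) (by positivity),
      Real.log_pow]
    push_cast
    linarith
  have hlog : Real.log 2 + (2 - κ) * Real.log k + 2 * Real.log (2 * (N : ℝ) ^ 2 + 1)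
      ≤ 6 * Real.log N := by
    have h1 := mul_le_mul_of_nonneg_left hlogk (by linarith : 0 ≤ 2 - κ)
    have h2 := mul_le_mul_of_nonneg_left hlogN hκ0.le
    have h3 := Real.log_two_lt_d9
    have h4 := Real.log_two_gt_d9
    nlinarith [sq_nonneg (κ - 0.73), mul_pos hκ0 (sub_pos.2 h4)]
  have hreal : (2 : ℝ) ^ N * ((k : ℝ) ^ (N - k) * (k : ℝ) ^ N * (2 * (N : ℝ) ^ 2 + 1) ^ (2 * N))
      ≤ (N : ℝ) ^ (6 * N) := by
    rw [← Real.log_le_log_iff (by positivity) (by positivity), Real.log_mul (by positivity)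
      (by positivity), Real.log_mul (by positivity) (by positivity), Real.log_mul (by positivity)
      (by positivity), Real.log_pow, Real.log_pow, Real.log_pow, Real.log_pow, Real.log_pow,
      Nat.cast_sub hk]
    have hsub : (N : ℝ) - k = (1 - κ) * N := by rw [hkκ]; ring
    rw [hsub]
    push_cast
    linarith [mul_le_mul_of_nonneg_left hlog hNpos.le]
  exact_mod_cast hreal

theorem card_blockLabelings_mul_le {N : ℕ} (hN : 30 ≤ N) :
    (blockLabelings (Fin N)).card * (2 * N ^ 2 + 1) ^ (2 * N) ≤ N ^ (6 * N) := by
  refine Nat.le_of_mul_le_mul_left (c := 2 ^ N) ?_ (by positivity)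
  have h := card_blockLabelings_le (Fin N)
  rw [Fintype.card_fin] at h
  calc 2 ^ N * ((blockLabelings (Fin N)).card * (2 * N ^ 2 + 1) ^ (2 * N))
      ≤ 2 ^ N * ((∑ R : Finset (Fin N), R.card ^ (N - R.card) * R.card ^ N) *
          (2 * N ^ 2 + 1) ^ (2 * N)) := by gcongr
    _ = ∑ R : Finset (Fin N),
          2 ^ N * (R.card ^ (N - R.card) * R.card ^ N * (2 * N ^ 2 + 1) ^ (2 * N)) := by
        rw [Finset.sum_mul, Finset.mul_sum]
    _ ≤ ∑ _R : Finset (Fin N), N ^ (6 * N) :=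
        Finset.sum_le_sum fun R _ => two_pow_mul_pow_le hN (by simpa using R.card_le_univ)
    _ = 2 ^ N * N ^ (6 * N) := by simp

theorem finite_and_ncard_sign_matrices_le (N : ℕ) :
    {M : Matrix (Fin N) (Fin N) ℝ | ∀ i j, M i j = 1 ∨ M i j = -1}.Finite ∧
    {M : Matrix (Fin N) (Fin N) ℝ | ∀ i j, M i j = 1 ∨ M i j = -1}.ncard ≤ 2 ^ (N * N) := by
  let f : (Fin N × Fin N → Bool) → Matrix (Fin N) (Fin N) ℝ :=
    fun b => Matrix.of fun i j => if b (i, j) then 1 else -1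
  have hsub : {M : Matrix (Fin N) (Fin N) ℝ | ∀ i j, M i j = 1 ∨ M i j = -1} ⊆ Set.range f := by
    intro M hM
    refine ⟨fun ij => decide (M ij.1 ij.2 = 1), ?_⟩
    ext i j
    rcases hM i j with h | h
    · simp [f, h]
    · simp only [f, Matrix.of_apply, h]; norm_num
  refine ⟨(Set.finite_range f).subset hsub,
    (Set.ncard_le_ncard hsub (Set.finite_range f)).trans ?_⟩
  rw [← Set.image_univ]
  refine (Set.ncard_image_le Set.finite_univ).trans ?_
  simp [Set.ncard_univ]

/-- The number of N x N sign matrices of sign spiky rank at most r <= N/2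
is at most N^(6rN). -/
theorem count_sign_matrices_small_signSpikyRank (N r : ℕ) (h : 2 * r ≤ N) :
    {M : Matrix (Fin N) (Fin N) ℝ |
      (∀ i j, M i j = 1 ∨ M i j = -1) ∧ signSpikyRank M ≤ r}.ncard
      ≤ N ^ (6 * r * N) := by
  rcases Nat.eq_zero_or_pos N with rfl | hN
  · simpa using Set.ncard_le_one_of_subsingleton
      {M : Matrix (Fin 0) (Fin 0) ℝ | (∀ i j, M i j = 1 ∨ M i j = -1) ∧ signSpikyRank M ≤ r}
  have : Nonempty (Fin N) := ⟨⟨0, hN⟩⟩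
  have hbound := ncard_signSpikyRank_le (α := Fin N) r
  rw [Fintype.card_fin] at hbound
  have hpow : N ^ (6 * r * N) = (N ^ (6 * N)) ^ r := by rw [← pow_mul]; congr 1; ring
  rcases Nat.eq_zero_or_pos r with rfl | hr
  · simpa using hbound
  rcases le_or_gt 30 N with hlarge | hsmall
  · rw [hpow]
    exact hbound.trans (Nat.pow_le_pow_left (card_blockLabelings_mul_le hlarge) r)
  · have h2N : 2 ^ N ≤ N ^ 6 := by
      have : 2 ≤ N := by omega
      interval_cases N <;> norm_num
    calc _ ≤ {M : Matrix (Fin N) (Fin N) ℝ | ∀ i j, M i j = 1 ∨ M i j = -1}.ncard :=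
          Set.ncard_le_ncard (fun M hM => hM.1) (finite_and_ncard_sign_matrices_le N).1
      _ ≤ 2 ^ (N * N) := (finite_and_ncard_sign_matrices_le N).2
      _ = (2 ^ N) ^ N := pow_mul _ _ _
      _ ≤ (N ^ 6) ^ N := Nat.pow_le_pow_left h2N N
      _ = N ^ (6 * 1 * N) := (pow_mul _ _ _).symm
      _ ≤ N ^ (6 * r * N) := Nat.pow_le_pow_right hN (by gcongr; exact hr)
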